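/- arXiv:2110.03238 — 5 statements merged into one kernel-verified Lean document; each statement's English description precedes it below -/
import Mathlib

section
/- Let u : ℝ^m → ℝ be a C² function that attains a local maximum at a point p, and let X : ℝ^m → ℝ^m be a differentiable vector field. Define the function Xu : ℝ^m → ℝ by (Xu)(x) = Du(x)(X(x)), where Du(x) is the Fréchet derivative of u at x. Then the second derivative of u along X at p is nonpositive: D(Xu)(p)(X(p)) ≤ 0. -/
/-- **Maximum principle along a vector field (Euclidean core).**
If `u : ℝ^m → ℝ` is `C²` and attains a local maximum at `p`, and `X` is a
differentiable vector field, then with `Xu (x) = Du(x)(X(x))`, we have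
`D(Xu)(p)(X(p)) ≤ 0`. -/
theorem second_derivative_along_field_nonpos_at_localMax {m : ℕ}
    (u : EuclideanSpace ℝ (Fin m) → ℝ)
    (X : EuclideanSpace ℝ (Fin m) → EuclideanSpace ℝ (Fin m))
    (p : EuclideanSpace ℝ (Fin m))
    (hu : ContDiff ℝ 2 u) (hX : Differentiable ℝ X) (hp : IsLocalMax u p) :
    fderiv ℝ (fun x => fderiv ℝ u x (X x)) p (X p) ≤ 0 := by
  have hdu : Differentiable ℝ u := hu.differentiable (by norm_num)
  have hddu : Differentiable ℝ (fderiv ℝ u) :=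
    (hu.fderiv_right (m := 1) (by norm_num)).differentiable (by norm_num)
  have h0 : fderiv ℝ u p = 0 := hp.fderiv_eq_zero
  have h1 : fderiv ℝ (fun x => fderiv ℝ u x (X x)) p (X p)
      = fderiv ℝ (fderiv ℝ u) p (X p) (X p) := by
    rw [fderiv_clm_apply (hddu p) (hX p)]
    simp [h0]
  rw [h1]
  generalize X p = v
  have hline : ∀ t : ℝ, HasDerivAt (fun t : ℝ => p + t • v) v t := fun t => by
    simpa using ((hasDerivAt_id t).smul_const v).const_add p
  have hg : ∀ t : ℝ, HasDerivAt (fun t : ℝ => u (p + t • v)) (fderiv ℝ u (p + t • v) v) t :=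
    fun t => (hdu _).hasFDerivAt.comp_hasDerivAt t (hline t)
  have hg' : deriv (fun t : ℝ => u (p + t • v)) = fun t => fderiv ℝ u (p + t • v) v :=
    funext fun t => (hg t).deriv
  have hgg : HasDerivAt (fun t : ℝ => fderiv ℝ u (p + t • v) v)
      (fderiv ℝ (fderiv ℝ u) p v v) 0 := by
    have h2 : HasDerivAt (fun t : ℝ => fderiv ℝ u (p + t • v))
        (fderiv ℝ (fderiv ℝ u) (p + (0 : ℝ) • v) v) 0 :=
      (hddu _).hasFDerivAt.comp_hasDerivAt (0 : ℝ) (hline 0)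
    simpa using h2.clm_apply (hasDerivAt_const (0 : ℝ) v)
  by_contra! hpos
  have hmin : IsLocalMin (fun t : ℝ => u (p + t • v)) 0 := by
    apply isLocalMin_of_deriv_deriv_pos
    · rw [hg', hgg.deriv]; exact hpos
    · rw [hg']; simp [h0]
    · exact (hg 0).continuousAt
  have hmax : ∀ᶠ t : ℝ in nhds 0, u (p + t • v) ≤ u p := by
    have hc : Filter.Tendsto (fun t : ℝ => p + t • v) (nhds 0) (nhds p) := by
      simpa using (hline 0).continuousAt.tendsto
    exact hc.eventually hp
  have heq : (fun t : ℝ => u (p + t • v)) =ᶠ[nhds 0] fun _ => u p := by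
    filter_upwards [hmin, hmax] with t ha hb
    simp only [zero_smul, add_zero] at ha
    exact le_antisymm hb ha
  have hd : deriv (deriv (fun t : ℝ => u (p + t • v))) 0 = 0 := by
    rw [heq.deriv.deriv_eq]
    simp
  rw [hg', hgg.deriv] at hd
  exact hpos.ne' hd
end

section
/- Let J : ℝ^m → (ℝ^m →L[ℝ] ℝ^m) be a C^∞ field of endomorphisms such that J(x) ∘ J(x) = −id_{ℝ^m} for every x ∈ ℝ^m (a pointwise almost complex structure). Then its complete lift J^C, defined by J^C(x,y)(v,w) = (J(x)(v), (DJ(x)(y))(v) + J(x)(w)), satisfies J^C(x,y) ∘ J^C(x,y) = −id_{ℝ^m × ℝ^m} for every (x,y) ∈ ℝ^m × ℝ^m. -/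
/-- Complete lift of a field of endomorphisms (a (1,1)-tensor field):
`A^C(x,y)(v,w) = (A(x)(v), (DA(x)(y))(v) + A(x)(w))`. -/
noncomputable def tensorCompLift {m : ℕ}
    (A : EuclideanSpace ℝ (Fin m) →
      (EuclideanSpace ℝ (Fin m) →L[ℝ] EuclideanSpace ℝ (Fin m)))
    (q vw : EuclideanSpace ℝ (Fin m) × EuclideanSpace ℝ (Fin m)) :
    EuclideanSpace ℝ (Fin m) × EuclideanSpace ℝ (Fin m) :=
  (A q.1 vw.1, fderiv ℝ A q.1 q.2 vw.1 + A q.1 vw.2)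

/-- **The complete lift of an almost complex structure squares to `−id`.** -/
theorem tensorCompLift_sq_neg_id {m : ℕ}
    (J : EuclideanSpace ℝ (Fin m) →
      (EuclideanSpace ℝ (Fin m) →L[ℝ] EuclideanSpace ℝ (Fin m)))
    (hJ : ContDiff ℝ (⊤ : ℕ∞) J)
    (hsq : ∀ x, (J x).comp (J x) =
      -(ContinuousLinearMap.id ℝ (EuclideanSpace ℝ (Fin m)))) :
    ∀ q vw : EuclideanSpace ℝ (Fin m) × EuclideanSpace ℝ (Fin m),
      tensorCompLift J q (tensorCompLift J q vw) = -vw := by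
  rintro ⟨x, y⟩ ⟨v, w⟩
  have hd : HasFDerivAt J (fderiv ℝ J x) x :=
    ((hJ.differentiable (by simp)) x).hasFDerivAt
  have h1 := hd.clm_comp hd
  have h2 : (fun z => (J z).comp (J z)) =
      fun _ => -(ContinuousLinearMap.id ℝ (EuclideanSpace ℝ (Fin m))) := funext hsq
  rw [h2] at h1
  have h3 := h1.unique (hasFDerivAt_const _ x)
  have h4 := congrArg (fun L => L y v) h3
  simp at h4
  have h5 : ∀ u, J x (J x u) = -u := fun u => by
    have := congrArg (fun L => L u) (hsq x)
    simpa using this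
  simp only [tensorCompLift, map_add, h5, Prod.neg_mk, Prod.mk.injEq, true_and]
  rw [← add_assoc, add_comm (fderiv ℝ J x y (J x v)), h4, zero_add]
end

section
/- Let J : ℝ^m → (ℝ^m →L[ℝ] ℝ^m) be a C^∞ field of endomorphisms and Z, W : ℝ^m → ℝ^m be C^∞ vector fields. Let J^C be the complete lift of J to ℝ^m × ℝ^m, and Z^V, W^V the vertical lifts of Z, W. Then the Nijenhuis torsion of J^C evaluated on the vertical lifts vanishes: N_{J^C}(Z^V, W^V)(x,y) = 0 for all (x,y) ∈ ℝ^m × ℝ^m. -/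
/-- Vertical lift of a vector field: `Z^V(x,y) = (0, Z(x))`. -/
noncomputable def vertLift {m : ℕ}
    (Z : EuclideanSpace ℝ (Fin m) → EuclideanSpace ℝ (Fin m)) :
    EuclideanSpace ℝ (Fin m) × EuclideanSpace ℝ (Fin m) →
      EuclideanSpace ℝ (Fin m) × EuclideanSpace ℝ (Fin m) :=
  fun q => (0, Z q.1)

/-- Complete lift of a vector field: `Z^C(x,y) = (Z(x), DZ(x)(y))`. -/
noncomputable def compLift {m : ℕ}
    (Z : EuclideanSpace ℝ (Fin m) → EuclideanSpace ℝ (Fin m)) :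
    EuclideanSpace ℝ (Fin m) × EuclideanSpace ℝ (Fin m) →
      EuclideanSpace ℝ (Fin m) × EuclideanSpace ℝ (Fin m) :=
  fun q => (Z q.1, fderiv ℝ Z q.1 q.2)

/-- Lie bracket of vector fields on a normed space:
`[X,Y](p) = DY(p)(X(p)) − DX(p)(Y(p))`. -/
noncomputable def lieBracket {F : Type*} [NormedAddCommGroup F] [NormedSpace ℝ F]
    (X Y : F → F) : F → F :=
  fun p => fderiv ℝ Y p (X p) - fderiv ℝ X p (Y p)

/-- Nijenhuis torsion of a pointwise endomorphism `J` (given as a function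
`F → F → F`) evaluated on vector fields `Z, W`:
`N_J(Z,W) = [JZ, JW] − J[JZ, W] − J[Z, JW] − [Z, W]`. -/
noncomputable def nijenhuis {F : Type*} [NormedAddCommGroup F] [NormedSpace ℝ F]
    (J : F → F → F) (Z W : F → F) : F → F :=
  fun p =>
    lieBracket (fun x => J x (Z x)) (fun x => J x (W x)) p
      - J p (lieBracket (fun x => J x (Z x)) W p)
      - J p (lieBracket Z (fun x => J x (W x)) p)
      - lieBracket Z W p

theorem lieBracket_vertLift_vertLift {m : ℕ}
    (X Y : EuclideanSpace ℝ (Fin m) → EuclideanSpace ℝ (Fin m))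
    (hX : Differentiable ℝ X) (hY : Differentiable ℝ Y)
    (q : EuclideanSpace ℝ (Fin m) × EuclideanSpace ℝ (Fin m)) :
    lieBracket (vertLift X) (vertLift Y) q = 0 := by
  have key : ∀ V : EuclideanSpace ℝ (Fin m) → EuclideanSpace ℝ (Fin m),
      Differentiable ℝ V → ∀ w : EuclideanSpace ℝ (Fin m),
      fderiv ℝ (vertLift V) q (0, w) = 0 := by
    intro V hV w
    have h1 : HasFDerivAt (fun p : EuclideanSpace ℝ (Fin m) × EuclideanSpace ℝ (Fin m) => V p.1)
        ((fderiv ℝ V q.1).comp (ContinuousLinearMap.fst ℝ _ _)) q :=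
      (hV q.1).hasFDerivAt.comp q hasFDerivAt_fst
    have h2 : HasFDerivAt (vertLift V) _ q :=
      (hasFDerivAt_const (0 : EuclideanSpace ℝ (Fin m)) q).prodMk h1
    rw [h2.fderiv]
    simp
  have hx := key X hX (Y q.1)
  have hy := key Y hY (X q.1)
  change fderiv ℝ (vertLift Y) q (0, X q.1) - fderiv ℝ (vertLift X) q (0, Y q.1) = 0
  rw [hx, hy, sub_zero]

theorem tensorCompLift_vertLift {m : ℕ}
    (J : EuclideanSpace ℝ (Fin m) →
      (EuclideanSpace ℝ (Fin m) →L[ℝ] EuclideanSpace ℝ (Fin m)))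
    (Z : EuclideanSpace ℝ (Fin m) → EuclideanSpace ℝ (Fin m)) :
    (fun x => tensorCompLift J x (vertLift Z x)) = vertLift (fun x => J x (Z x)) := by
  funext x
  simp [tensorCompLift, vertLift]

/-- **The Nijenhuis torsion of the complete lift vanishes on vertical lifts:**
`N_{J^C}(Z^V, W^V) = 0`. -/
theorem nijenhuis_compLift_vertLift_vertLift {m : ℕ}
    (J : EuclideanSpace ℝ (Fin m) →
      (EuclideanSpace ℝ (Fin m) →L[ℝ] EuclideanSpace ℝ (Fin m)))
    (Z W : EuclideanSpace ℝ (Fin m) → EuclideanSpace ℝ (Fin m))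
    (hJ : ContDiff ℝ (⊤ : ℕ∞) J)
    (hZ : ContDiff ℝ (⊤ : ℕ∞) Z) (hW : ContDiff ℝ (⊤ : ℕ∞) W) :
    ∀ q : EuclideanSpace ℝ (Fin m) × EuclideanSpace ℝ (Fin m),
      nijenhuis (tensorCompLift J) (vertLift Z) (vertLift W) q = 0 := by
  intro q
  have dJ : Differentiable ℝ J := hJ.differentiable (by simp)
  have dZ : Differentiable ℝ Z := hZ.differentiable (by simp)
  have dW : Differentiable ℝ W := hW.differentiable (by simp)
  have dJZ : Differentiable ℝ (fun x => J x (Z x)) := dJ.clm_apply dZ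
  have dJW : Differentiable ℝ (fun x => J x (W x)) := dJ.clm_apply dW
  unfold nijenhuis
  rw [tensorCompLift_vertLift, tensorCompLift_vertLift,
    lieBracket_vertLift_vertLift _ _ dJZ dJW, lieBracket_vertLift_vertLift _ _ dJZ dW,
    lieBracket_vertLift_vertLift _ _ dZ dJW, lieBracket_vertLift_vertLift _ _ dZ dW]
  simp [tensorCompLift]
end

section
/- Let J : ℝ^m → (ℝ^m →L[ℝ] ℝ^m) be a C^∞ field of endomorphisms and Z, W : ℝ^m → ℝ^m be C^∞ vector fields. Let J^C be the complete lift of J to ℝ^m × ℝ^m and Z^C, W^C the complete lifts of Z, W. Then the Nijenhuis torsion satisfies N_{J^C}(Z^C, W^C) = (N_J(Z, W))^C, i.e. the Nijenhuis torsion of the complete lift evaluated on complete lifts equals the complete lift of the Nijenhuis torsion of J evaluated on Z and W, at every point of ℝ^m × ℝ^m. -/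
theorem aux_tensor {m : ℕ}
    (J : EuclideanSpace ℝ (Fin m) →
      (EuclideanSpace ℝ (Fin m) →L[ℝ] EuclideanSpace ℝ (Fin m)))
    (Z : EuclideanSpace ℝ (Fin m) → EuclideanSpace ℝ (Fin m))
    (hJ : ContDiff ℝ (⊤ : ℕ∞) J) (hZ : ContDiff ℝ (⊤ : ℕ∞) Z)
    (q : EuclideanSpace ℝ (Fin m) × EuclideanSpace ℝ (Fin m)) :
    tensorCompLift J q (compLift Z q) = compLift (fun x => J x (Z x)) q := by
  have h1 : DifferentiableAt ℝ J q.1 := (hJ.differentiable (by simp)) _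
  have h2 : DifferentiableAt ℝ Z q.1 := (hZ.differentiable (by simp)) _
  simp only [tensorCompLift, compLift]
  rw [fderiv_clm_apply h1 h2]
  simp [add_comm]

theorem aux_fderiv {m : ℕ}
    (Z : EuclideanSpace ℝ (Fin m) → EuclideanSpace ℝ (Fin m))
    (hZ : ContDiff ℝ (⊤ : ℕ∞) Z)
    (q v : EuclideanSpace ℝ (Fin m) × EuclideanSpace ℝ (Fin m)) :
    fderiv ℝ (compLift Z) q v =
      (fderiv ℝ Z q.1 v.1, fderiv ℝ (fderiv ℝ Z) q.1 v.1 q.2 + fderiv ℝ Z q.1 v.2) := by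
  have h2 : DifferentiableAt ℝ Z q.1 := (hZ.differentiable (by simp)) _
  have h3 : DifferentiableAt ℝ (fderiv ℝ Z) q.1 :=
    ((hZ.fderiv_right (m := (⊤ : ℕ∞)) (by simp)).differentiable (by simp)) _
  have a := h2.hasFDerivAt.comp q (hasFDerivAt_fst (𝕜 := ℝ) (p := q))
  have b := h3.hasFDerivAt.comp q (hasFDerivAt_fst (𝕜 := ℝ) (p := q))
  have c := b.clm_apply (hasFDerivAt_snd (𝕜 := ℝ) (p := q))
  have d : HasFDerivAt (compLift Z) _ q := a.prodMk c
  rw [d.fderiv]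
  simp [add_comm]

theorem aux_bracket_smooth {m : ℕ}
    (X Y : EuclideanSpace ℝ (Fin m) → EuclideanSpace ℝ (Fin m))
    (hX : ContDiff ℝ (⊤ : ℕ∞) X) (hY : ContDiff ℝ (⊤ : ℕ∞) Y) :
    ContDiff ℝ (⊤ : ℕ∞) (lieBracket X Y) := by
  have h1 : ContDiff ℝ (⊤ : ℕ∞) (fderiv ℝ X) := hX.fderiv_right (by simp)
  have h2 : ContDiff ℝ (⊤ : ℕ∞) (fderiv ℝ Y) := hY.fderiv_right (by simp)
  exact (h2.clm_apply hX).sub (h1.clm_apply hY)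

theorem aux_bracket {m : ℕ}
    (X Y : EuclideanSpace ℝ (Fin m) → EuclideanSpace ℝ (Fin m))
    (hX : ContDiff ℝ (⊤ : ℕ∞) X) (hY : ContDiff ℝ (⊤ : ℕ∞) Y)
    (q : EuclideanSpace ℝ (Fin m) × EuclideanSpace ℝ (Fin m)) :
    lieBracket (compLift X) (compLift Y) q = compLift (lieBracket X Y) q := by
  have h1 : ContDiff ℝ (⊤ : ℕ∞) (fderiv ℝ X) := hX.fderiv_right (by simp)
  have h2 : ContDiff ℝ (⊤ : ℕ∞) (fderiv ℝ Y) := hY.fderiv_right (by simp)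
  have dX : DifferentiableAt ℝ X q.1 := (hX.differentiable (by simp)) _
  have dY : DifferentiableAt ℝ Y q.1 := (hY.differentiable (by simp)) _
  have d1 : DifferentiableAt ℝ (fderiv ℝ X) q.1 := (h1.differentiable (by simp)) _
  have d2 : DifferentiableAt ℝ (fderiv ℝ Y) q.1 := (h2.differentiable (by simp)) _
  have sX : IsSymmSndFDerivAt ℝ X q.1 :=
    hX.contDiffAt.isSymmSndFDerivAt (by simp; exact WithTop.coe_le_coe.2 (le_top (a := (2 : ℕ∞))))
  have sY : IsSymmSndFDerivAt ℝ Y q.1 :=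
    hY.contDiffAt.isSymmSndFDerivAt (by simp; exact WithTop.coe_le_coe.2 (le_top (a := (2 : ℕ∞))))
  have e : HasFDerivAt (lieBracket X Y) _ q.1 :=
    (d2.hasFDerivAt.clm_apply dX.hasFDerivAt).sub (d1.hasFDerivAt.clm_apply dY.hasFDerivAt)
  have e1 : lieBracket (compLift X) (compLift Y) q =
    fderiv ℝ (compLift Y) q (compLift X q) - fderiv ℝ (compLift X) q (compLift Y q) := rfl
  have e2 : compLift (lieBracket X Y) q =
    (lieBracket X Y q.1, fderiv ℝ (lieBracket X Y) q.1 q.2) := rfl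
  rw [e1, e2, aux_fderiv X hX, aux_fderiv Y hY, e.fderiv]
  refine Prod.ext ?_ ?_
  · simp [compLift, lieBracket]
  · simp [compLift]
    rw [sX.eq (Y q.1) q.2, sY.eq (X q.1) q.2]
    abel

theorem aux_sub {m : ℕ}
    (X Y : EuclideanSpace ℝ (Fin m) → EuclideanSpace ℝ (Fin m))
    (hX : ContDiff ℝ (⊤ : ℕ∞) X) (hY : ContDiff ℝ (⊤ : ℕ∞) Y)
    (q : EuclideanSpace ℝ (Fin m) × EuclideanSpace ℝ (Fin m)) :
    compLift (fun x => X x - Y x) q = compLift X q - compLift Y q := by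
  have dX : DifferentiableAt ℝ X q.1 := (hX.differentiable (by simp)) _
  have dY : DifferentiableAt ℝ Y q.1 := (hY.differentiable (by simp)) _
  simp only [compLift]
  rw [fderiv_fun_sub dX dY]
  simp

/-- **Yano–Ishihara:** `N_{J^C}(Z^C, W^C) = (N_J(Z, W))^C`. -/
theorem nijenhuis_compLift_compLift_compLift {m : ℕ}
    (J : EuclideanSpace ℝ (Fin m) →
      (EuclideanSpace ℝ (Fin m) →L[ℝ] EuclideanSpace ℝ (Fin m)))
    (Z W : EuclideanSpace ℝ (Fin m) → EuclideanSpace ℝ (Fin m))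
    (hJ : ContDiff ℝ (⊤ : ℕ∞) J)
    (hZ : ContDiff ℝ (⊤ : ℕ∞) Z) (hW : ContDiff ℝ (⊤ : ℕ∞) W) :
    ∀ q : EuclideanSpace ℝ (Fin m) × EuclideanSpace ℝ (Fin m),
      nijenhuis (tensorCompLift J) (compLift Z) (compLift W) q =
        compLift (nijenhuis (fun x v => J x v) Z W) q := by
  intro q
  have hA := hJ.clm_apply hZ
  have hB := hJ.clm_apply hW
  have b1 := aux_bracket_smooth _ _ hA hB
  have b2 := hJ.clm_apply (aux_bracket_smooth _ _ hA hW)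
  have b3 := hJ.clm_apply (aux_bracket_smooth _ _ hZ hB)
  have b4 := aux_bracket_smooth _ _ hZ hW
  unfold nijenhuis
  rw [aux_sub _ _ ((b1.sub b2).sub b3) b4, aux_sub _ _ (b1.sub b2) b3, aux_sub _ _ b1 b2,
    ← aux_tensor J _ hJ (aux_bracket_smooth _ _ hA hW),
    ← aux_tensor J _ hJ (aux_bracket_smooth _ _ hZ hB)]
  rw [← aux_bracket _ _ hA hB, ← aux_bracket _ _ hA hW, ← aux_bracket _ _ hZ hB,
    ← aux_bracket _ _ hZ hW]
  have tZ : (fun x => tensorCompLift J x (compLift Z x)) = compLift (fun x => J x (Z x)) :=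
    funext (aux_tensor J Z hJ hZ)
  have tW : (fun x => tensorCompLift J x (compLift W x)) = compLift (fun x => J x (W x)) :=
    funext (aux_tensor J W hJ hW)
  rw [tZ, tW]
end

section
/- Let J : ℝ^m → (ℝ^m →L[ℝ] ℝ^m) be a C^∞ field of endomorphisms and Z, W : ℝ^m → ℝ^m be C^∞ vector fields. Let J^C be the complete lift of J to ℝ^m × ℝ^m, Z^C the complete lift of Z and W^V the vertical lift of W. Then the Nijenhuis torsion satisfies N_{J^C}(Z^C, W^V) = (N_J(Z, W))^V, i.e. N_{J^C}(Z^C, W^V)(x,y) = (0, N_J(Z,W)(x)) for all (x,y) ∈ ℝ^m × ℝ^m. -/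
theorem lieBracket_compLift_vertLift_aux {m : ℕ}
    (X Y : EuclideanSpace ℝ (Fin m) → EuclideanSpace ℝ (Fin m))
    (hX : ContDiff ℝ (⊤ : ℕ∞) X) (hY : ContDiff ℝ (⊤ : ℕ∞) Y) :
    lieBracket (compLift X) (vertLift Y) = vertLift (lieBracket X Y) := by
  funext q
  have hX1 : HasFDerivAt X (fderiv ℝ X q.1) q.1 :=
    ((hX.differentiable (by simp)) q.1).hasFDerivAt
  have hY1 : HasFDerivAt Y (fderiv ℝ Y q.1) q.1 :=
    ((hY.differentiable (by simp)) q.1).hasFDerivAt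
  have hd : ContDiff ℝ (⊤ : ℕ∞) (fderiv ℝ X) := hX.fderiv_right (by simp)
  have hX2 : HasFDerivAt (fderiv ℝ X) (fderiv ℝ (fderiv ℝ X) q.1) q.1 :=
    ((hd.differentiable (by simp)) q.1).hasFDerivAt
  have h1 : HasFDerivAt (compLift X) _ q :=
    (hX1.comp q hasFDerivAt_fst).prodMk
      ((hX2.comp q hasFDerivAt_fst).clm_apply hasFDerivAt_snd)
  have h2 : HasFDerivAt (vertLift Y) _ q :=
    (hasFDerivAt_const (0 : EuclideanSpace ℝ (Fin m)) q).prodMk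
      (hY1.comp q hasFDerivAt_fst)
  unfold lieBracket
  rw [h1.fderiv, h2.fderiv]
  simp [compLift, vertLift]

theorem tensorCompLift_compLift_aux {m : ℕ}
    (J : EuclideanSpace ℝ (Fin m) →
      (EuclideanSpace ℝ (Fin m) →L[ℝ] EuclideanSpace ℝ (Fin m)))
    (Z : EuclideanSpace ℝ (Fin m) → EuclideanSpace ℝ (Fin m))
    (hJ : ContDiff ℝ (⊤ : ℕ∞) J) (hZ : ContDiff ℝ (⊤ : ℕ∞) Z) :
    (fun q => tensorCompLift J q (compLift Z q)) = compLift (fun x => J x (Z x)) := by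
  funext q
  have hZ1 : HasFDerivAt Z (fderiv ℝ Z q.1) q.1 :=
    ((hZ.differentiable (by simp)) q.1).hasFDerivAt
  have hJ1 : HasFDerivAt J (fderiv ℝ J q.1) q.1 :=
    ((hJ.differentiable (by simp)) q.1).hasFDerivAt
  unfold tensorCompLift compLift
  rw [(hJ1.clm_apply hZ1).fderiv]
  simp [add_comm]

theorem tensorCompLift_vertLift_aux {m : ℕ}
    (J : EuclideanSpace ℝ (Fin m) →
      (EuclideanSpace ℝ (Fin m) →L[ℝ] EuclideanSpace ℝ (Fin m)))
    (Z : EuclideanSpace ℝ (Fin m) → EuclideanSpace ℝ (Fin m)) :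
    (fun q => tensorCompLift J q (vertLift Z q)) = vertLift (fun x => J x (Z x)) := by
  funext q
  simp [tensorCompLift, vertLift]

/-- **Yano–Ishihara:** `N_{J^C}(Z^C, W^V) = (N_J(Z, W))^V`, i.e.
`N_{J^C}(Z^C, W^V)(x,y) = (0, N_J(Z,W)(x))`. -/
theorem nijenhuis_compLift_compLift_vertLift {m : ℕ}
    (J : EuclideanSpace ℝ (Fin m) →
      (EuclideanSpace ℝ (Fin m) →L[ℝ] EuclideanSpace ℝ (Fin m)))
    (Z W : EuclideanSpace ℝ (Fin m) → EuclideanSpace ℝ (Fin m))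
    (hJ : ContDiff ℝ (⊤ : ℕ∞) J)
    (hZ : ContDiff ℝ (⊤ : ℕ∞) Z) (hW : ContDiff ℝ (⊤ : ℕ∞) W) :
    ∀ q : EuclideanSpace ℝ (Fin m) × EuclideanSpace ℝ (Fin m),
      nijenhuis (tensorCompLift J) (compLift Z) (vertLift W) q =
        (0, nijenhuis (fun x v => J x v) Z W q.1) := by
  intro q
  have hJZ : ContDiff ℝ (⊤ : ℕ∞) (fun x => J x (Z x)) := hJ.clm_apply hZ
  have hJW : ContDiff ℝ (⊤ : ℕ∞) (fun x => J x (W x)) := hJ.clm_apply hW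
  unfold nijenhuis
  rw [tensorCompLift_compLift_aux J Z hJ hZ, tensorCompLift_vertLift_aux J W,
    lieBracket_compLift_vertLift_aux _ _ hJZ hJW,
    lieBracket_compLift_vertLift_aux _ _ hJZ hW,
    lieBracket_compLift_vertLift_aux _ _ hZ hJW,
    lieBracket_compLift_vertLift_aux _ _ hZ hW]
  simp [tensorCompLift, vertLift]
end
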